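/- arXiv:1409.3216 — 16 statements merged into one kernel-verified Lean document; each statement's English description precedes it below -/
import Mathlib

section
/- Let G be a group and ω a normalized 4-cocycle on G. Then for every u ∈ G the twisted 3-cocycle [·,·,·]_u obtained from ω by the slant product satisfies the twisted 3-cocycle condition: for all u, w, x, y, z ∈ G, [x,y,z]_{w⁻¹uw} · [w,xy,z]_u · [w,x,y]_u = [wx,y,z]_u · [w,x,yz]_u; moreover it is normalized: [1,y,z]_u = [x,1,z]_u = [x,y,1]_u = 1 for all x, y, z, u ∈ G. -/
/-- A normalized 4-cocycle on a group `G` valued in `ℂˣ`. -/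
def IsNormalized4Cocycle {G : Type*} [Group G] (ω : G → G → G → G → ℂˣ) : Prop :=
  (∀ g₀ g₁ g₂ g₃ g₄ : G,
      ω g₁ g₂ g₃ g₄ * ω g₀ (g₁ * g₂) g₃ g₄ * ω g₀ g₁ g₂ (g₃ * g₄) =
        ω (g₀ * g₁) g₂ g₃ g₄ * ω g₀ g₁ (g₂ * g₃) g₄ * ω g₀ g₁ g₂ g₃) ∧
  (∀ g h k : G, ω 1 g h k = 1 ∧ ω g 1 h k = 1 ∧ ω g h 1 k = 1 ∧ ω g h k 1 = 1)

/-- The twisted 3-cocycle `[x,y,z]_u` obtained from `ω` by the slant product. -/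
def twisted3 {G : Type*} [Group G] (ω : G → G → G → G → ℂˣ) (u x y z : G) : ℂˣ :=
  ω x (x⁻¹ * u * x) y z * ω x y z ((x * y * z)⁻¹ * u * (x * y * z)) *
    (ω u x y z * ω x y ((x * y)⁻¹ * u * (x * y)) z)⁻¹

/-- The twisted 3-cocycle of a normalized 4-cocycle satisfies the twisted 3-cocycle
condition and is normalized. -/
theorem twisted3_cocycle_condition_and_normalized {G : Type*} [Group G]
    (ω : G → G → G → G → ℂˣ) (hω : IsNormalized4Cocycle ω) :
    (∀ u w x y z : G,
      twisted3 ω (w⁻¹ * u * w) x y z * twisted3 ω u w (x * y) z * twisted3 ω u w x y =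
        twisted3 ω u (w * x) y z * twisted3 ω u w x (y * z)) ∧
    (∀ u x y z : G,
      twisted3 ω u 1 y z = 1 ∧ twisted3 ω u x 1 z = 1 ∧ twisted3 ω u x y 1 = 1) := by
  obtain ⟨hc, hn⟩ := hω
  constructor
  · intro u w x y z
    have key : ∀ u₁ u₂ u₃ u₄ : G, u * w = w * u₁ → u₁ * x = x * u₂ → u₂ * y = y * u₃ →
        u₃ * z = z * u₄ →
        (ω x u₂ y z * ω x y z u₄ * (ω u₁ x y z * ω x y u₃ z)⁻¹) *
        (ω w u₁ (x * y) z * ω w (x * y) z u₄ * (ω u w (x * y) z * ω w (x * y) u₃ z)⁻¹) *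
        (ω w u₁ x y * ω w x y u₃ * (ω u w x y * ω w x u₂ y)⁻¹) =
        (ω (w * x) u₂ y z * ω (w * x) y z u₄ * (ω u (w * x) y z * ω (w * x) y u₃ z)⁻¹) *
        (ω w u₁ x (y * z) * ω w x (y * z) u₄ * (ω u w x (y * z) * ω w x u₂ (y * z))⁻¹) := by
      intro u₁ u₂ u₃ u₄ e₁ e₂ e₃ e₄
      have h0 := congrArg Additive.ofMul (hc u w x y z)
      have h1 := congrArg Additive.ofMul (hc w u₁ x y z)
      have h2 := congrArg Additive.ofMul (hc w x u₂ y z)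
      have h3 := congrArg Additive.ofMul (hc w x y u₃ z)
      have h4 := congrArg Additive.ofMul (hc w x y z u₄)
      rw [e₁] at h0
      rw [e₂] at h1
      rw [e₃] at h2
      rw [e₄] at h3
      apply Additive.ofMul.injective
      simp only [ofMul_mul, ofMul_inv] at *
      linear_combination (norm := abel) h0 - h1 + h2 - h3 + h4
    have k := key (w⁻¹ * u * w) ((w * x)⁻¹ * u * (w * x)) ((w * x * y)⁻¹ * u * (w * x * y))
      ((w * x * y * z)⁻¹ * u * (w * x * y * z)) (by group) (by group) (by group) (by group)
    have a₁ : x⁻¹ * (w⁻¹ * u * w) * x = (w * x)⁻¹ * u * (w * x) := by group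
    have a₂ : (x * y)⁻¹ * (w⁻¹ * u * w) * (x * y) = (w * x * y)⁻¹ * u * (w * x * y) := by group
    have a₃ : (x * y * z)⁻¹ * (w⁻¹ * u * w) * (x * y * z) =
      (w * x * y * z)⁻¹ * u * (w * x * y * z) := by group
    unfold twisted3
    rw [a₁, a₂, a₃]
    simp only [← mul_assoc w, ← mul_assoc (w * x)] at k ⊢
    exact k
  · intro u x y z
    have n1 := fun g h k => (hn g h k).1
    have n2 := fun g h k => (hn g h k).2.1
    have n3 := fun g h k => (hn g h k).2.2.1
    have n4 := fun g h k => (hn g h k).2.2.2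
    refine ⟨?_, ?_, ?_⟩ <;> simp [twisted3, n1, n2, n3, n4]
end

section
/- Let G be a group and ω a normalized 4-cocycle on G, with associated doubly-twisted 2-cochains β_{x,w}. Then β is normalized, i.e. β_{x,w}(1,z) = β_{x,w}(y,1) = 1 for all x, w, y, z ∈ G, and for every pair w, u ∈ G with wu = uw it satisfies the doubly-twisted 2-cocycle condition: for all x, y, z ∈ G, β_{x⁻¹wx, x⁻¹ux}(y,z) · β_{w,u}(x,yz) = β_{w,u}(xy,z) · β_{w,u}(x,y). -/
/-- The doubly-twisted 2-cochain `β_{x,w}(y,z)` of `ω`. -/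
def dtwisted2 {G : Type*} [Group G] (ω : G → G → G → G → ℂˣ) (x w y z : G) : ℂˣ :=
  twisted3 ω x w y z * twisted3 ω x y z ((y * z)⁻¹ * w * (y * z)) *
    (twisted3 ω x y (y⁻¹ * w * y) z)⁻¹

/-- The function `η^{a,b}(c,x) = β_{a,b}(c,x⁻¹) · β_{a,b}(x⁻¹, x c x⁻¹)⁻¹`. -/
def etaFn {G : Type*} [Group G] (ω : G → G → G → G → ℂˣ) (a b c x : G) : ℂˣ :=
  dtwisted2 ω a b c x⁻¹ * (dtwisted2 ω a b x⁻¹ (x * c * x⁻¹))⁻¹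

/-- Additive form of the slant product computation (3-cocycle from 4-cocycle). -/
lemma slant3_aux {G A : Type*} [Group G] [AddCommGroup A] (f : G → G → G → G → A)
    (hf : ∀ a b c d e : G, f b c d e + f a (b * c) d e + f a b c (d * e) =
      f (a * b) c d e + f a b (c * d) e + f a b c d)
    (u0 u1 u2 u3 u4 x y z k : G) (h0 : u0 * x = x * u1) (h1 : u1 * y = y * u2)
    (h2 : u2 * z = z * u3) (h3 : u3 * k = k * u4) :
    (f y u2 z k + f y z k u4 - (f u1 y z k + f y z u3 k)) +
      (f x u1 (y * z) k + f x (y * z) k u4 - (f u0 x (y * z) k + f x (y * z) u3 k)) +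
      (f x u1 y z + f x y z u3 - (f u0 x y z + f x y u2 z)) =
    (f (x * y) u2 z k + f (x * y) z k u4 - (f u0 (x * y) z k + f (x * y) z u3 k)) +
      (f x u1 y (z * k) + f x y (z * k) u4 - (f u0 x y (z * k) + f x y u2 (z * k))) := by
  have e0 := hf u0 x y z k
  have e1 := hf x u1 y z k
  have e2 := hf x y u2 z k
  have e3 := hf x y z u3 k
  have e4 := hf x y z k u4
  rw [h0] at e0
  rw [h1] at e1
  rw [h2] at e2
  rw [h3] at e3
  linear_combination (norm := abel) e0 - e1 + e2 - e3 + e4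

/-- The twisted 3-cocycle condition. -/
lemma twisted3_cocycle {G : Type*} [Group G] (ω : G → G → G → G → ℂˣ)
    (hω : IsNormalized4Cocycle ω) (u v x y z k : G) (hv : v = x⁻¹ * u * x) :
    twisted3 ω v y z k * twisted3 ω u x (y * z) k * twisted3 ω u x y z =
      twisted3 ω u (x * y) z k * twisted3 ω u x y (z * k) := by
  subst hv
  have := slant3_aux (A := Additive ℂˣ) (fun a b c d => Additive.ofMul (ω a b c d))
    (fun a b c d e => congrArg Additive.ofMul (hω.1 a b c d e))
    u (x⁻¹ * u * x) ((x * y)⁻¹ * u * (x * y)) ((x * y * z)⁻¹ * u * (x * y * z))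
    ((x * y * z * k)⁻¹ * u * (x * y * z * k)) x y z k
    (by group) (by group) (by group) (by group)
  have := congrArg Additive.toMul this
  simp only [toMul_add, toMul_sub, toMul_ofMul, div_eq_mul_inv] at this
  simp only [twisted3]
  simpa only [mul_assoc, mul_inv_rev, inv_mul_cancel_left] using this

/-- Additive form of the second slant product computation (2-cocycle from 3-cocycle). -/
lemma slant2_aux {G A : Type*} [Group G] [AddCommGroup A] (t s : G → G → G → A)
    (u0 u1 u2 u3 x y z : G) (h0 : u0 * x = x * u1) (h1 : u1 * y = y * u2)
    (h2 : u2 * z = z * u3)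
    (hu : ∀ b c d, t b c d + t u0 (b * c) d + t u0 b c = t (u0 * b) c d + t u0 b (c * d))
    (hx : ∀ b c d, s b c d + t x (b * c) d + t x b c = t (x * b) c d + t x b (c * d)) :
    (s u1 y z + s y z u3 - s y u2 z) +
      (t u0 x (y * z) + t x (y * z) u3 - t x u1 (y * z)) =
    (t u0 (x * y) z + t (x * y) z u3 - t (x * y) u2 z) +
      (t u0 x y + t x y u2 - t x u1 y) := by
  have e0 := hu x y z
  have e1 := hx u1 y z
  have e2 := hx y u2 z
  have e3 := hx y z u3
  rw [h0] at e0
  rw [h1] at e1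
  rw [h2] at e2
  linear_combination (norm := abel) e1 - e0 - e2 + e3

/-- The doubly-twisted 2-cochain of a normalized 4-cocycle is normalized and satisfies the
doubly-twisted 2-cocycle condition whenever the two twisting elements commute. -/
theorem dtwisted2_cocycle_condition_and_normalized {G : Type*} [Group G]
    (ω : G → G → G → G → ℂˣ) (hω : IsNormalized4Cocycle ω) :
    (∀ x w y z : G, dtwisted2 ω x w 1 z = 1 ∧ dtwisted2 ω x w y 1 = 1) ∧
    (∀ w u : G, w * u = u * w → ∀ x y z : G,
      dtwisted2 ω (x⁻¹ * w * x) (x⁻¹ * u * x) y z * dtwisted2 ω w u x (y * z) =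
        dtwisted2 ω w u (x * y) z * dtwisted2 ω w u x y) := by
  obtain ⟨h, hn⟩ := id hω
  refine ⟨fun x w y z => ?_, fun w u hc x y z => ?_⟩
  · have n1 := fun g h k => (hn g h k).1
    have n2 := fun g h k => (hn g h k).2.1
    have n3 := fun g h k => (hn g h k).2.2.1
    have n4 := fun g h k => (hn g h k).2.2.2
    constructor <;> simp [dtwisted2, twisted3, n1, n2, n3, n4]
  · have hw : w = u⁻¹ * w * u := by rw [mul_assoc, hc, inv_mul_cancel_left]
    have := slant2_aux (A := Additive ℂˣ) (fun a b c => Additive.ofMul (twisted3 ω w a b c))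
      (fun a b c => Additive.ofMul (twisted3 ω (x⁻¹ * w * x) a b c))
      u (x⁻¹ * u * x) ((x * y)⁻¹ * u * (x * y)) ((x * y * z)⁻¹ * u * (x * y * z)) x y z
      (by group) (by group) (by group)
      (fun b c d => congrArg Additive.ofMul (twisted3_cocycle ω hω w w u b c d hw))
      (fun b c d => congrArg Additive.ofMul (twisted3_cocycle ω hω w _ x b c d rfl))
    have := congrArg Additive.toMul this
    simp only [toMul_add, toMul_sub, toMul_ofMul, div_eq_mul_inv] at this
    simp only [dtwisted2]
    simpa only [mul_assoc, mul_inv_rev] using this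
end

section
/- Let G be a group and ω a normalized 4-cocycle on G, with associated doubly-twisted 2-cochains β_{a,b}. Then for all a, b ∈ G with ab = ba and all c, d ∈ G, β_{a,b}(c,d) = β_{b,a}(c,d)⁻¹. -/
/-- Expansion of `dtwisted2` for commuting twisting elements as the signed sum over shuffles. -/
theorem dtwisted2_expand {G : Type*} [Group G] (ω : G → G → G → G → ℂˣ)
    (a b : G) (hab : a * b = b * a) (c d : G) :
    dtwisted2 ω a b c d =
      ω b a c d * ω b c d ((c * d)⁻¹ * a * (c * d)) *
        (ω a b c d * ω b c (c⁻¹ * a * c) d)⁻¹ *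
      (ω c (c⁻¹ * a * c) d ((c * d)⁻¹ * b * (c * d)) *
        ω c d ((c * d)⁻¹ * b * (c * d)) ((c * d)⁻¹ * a * (c * d)) *
        (ω a c d ((c * d)⁻¹ * b * (c * d)) *
          ω c d ((c * d)⁻¹ * a * (c * d)) ((c * d)⁻¹ * b * (c * d)))⁻¹) *
      (ω c (c⁻¹ * a * c) (c⁻¹ * b * c) d *
        ω c (c⁻¹ * b * c) d ((c * d)⁻¹ * a * (c * d)) *
        (ω a c (c⁻¹ * b * c) d * ω c (c⁻¹ * b * c) (c⁻¹ * a * c) d)⁻¹)⁻¹ := by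
  have h0 : b⁻¹ * a * b = a := by rw [mul_assoc, hab, inv_mul_cancel_left]
  have key : ∀ p : G, (b * p)⁻¹ * a * (b * p) = p⁻¹ * a * p := by
    intro p
    calc (b * p)⁻¹ * a * (b * p) = p⁻¹ * (b⁻¹ * a * b) * p := by group
      _ = _ := by rw [h0]
  have e1 : c * d * ((c * d)⁻¹ * b * (c * d)) = b * (c * d) := by group
  have e2 : c * (c⁻¹ * b * c) = b * c := by group
  unfold dtwisted2 twisted3
  rw [e1, e2, h0, mul_assoc b c d, key, key]

/-- For commuting twisting elements, `β_{a,b}(c,d) = β_{b,a}(c,d)⁻¹`. -/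
theorem dtwisted2_swap_inv {G : Type*} [Group G]
    (ω : G → G → G → G → ℂˣ) (hω : IsNormalized4Cocycle ω)
    (a b : G) (hab : a * b = b * a) :
    ∀ c d : G, dtwisted2 ω a b c d = (dtwisted2 ω b a c d)⁻¹ := by
  intro c d
  rw [dtwisted2_expand ω a b hab, dtwisted2_expand ω b a hab.symm]
  apply eq_inv_of_mul_eq_one_left
  apply Units.ext
  push_cast
  field_simp
end

section
/- Let G be a group and ω a normalized 4-cocycle on G, with associated doubly-twisted 2-cochains β_{a,b} and associated function η. Then η^{k,g}(g,x) = 1 for all g, k, x ∈ G; and for all k, g ∈ G with kg = gk and all x ∈ G, η^{k,g}(k,x) = 1. -/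
/-- `η^{k,g}(g,x) = 1` for all `g,k,x`, and `η^{k,g}(k,x) = 1` whenever `kg = gk`. -/
theorem etaFn_eq_one_of_arg_eq_twist {G : Type*} [Group G]
    (ω : G → G → G → G → ℂˣ) (hω : IsNormalized4Cocycle ω) :
    (∀ g k x : G, etaFn ω k g g x = 1) ∧
    (∀ k g : G, k * g = g * k → ∀ x : G, etaFn ω k g k x = 1) := by
  clear hω
  refine ⟨fun g k x => ?_, fun k g hkg x => ?_⟩
  · have e1 : (g * x⁻¹)⁻¹ * g * (g * x⁻¹) = x * g * x⁻¹ := by group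
    have e2 : (x⁻¹ * (x * g * x⁻¹))⁻¹ * g * (x⁻¹ * (x * g * x⁻¹)) = x * g * x⁻¹ := by group
    have e3 : x⁻¹⁻¹ * g * x⁻¹ = x * g * x⁻¹ := by group
    have e4 : g⁻¹ * g * g = g := by group
    unfold etaFn dtwisted2
    rw [e1, e2, e3, e4]
    generalize twisted3 ω k g g x⁻¹ = A
    generalize twisted3 ω k g x⁻¹ (x * g * x⁻¹) = B
    generalize twisted3 ω k x⁻¹ (x * g * x⁻¹) (x * g * x⁻¹) = C
    simp [mul_comm]
  · have hc : k⁻¹ * g * k = g := by rw [mul_assoc, ← hkg, inv_mul_cancel_left]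
    have hc' : g⁻¹ * k * g = k := by rw [mul_assoc, hkg, inv_mul_cancel_left]
    obtain ⟨y, rfl⟩ : ∃ y, x = y⁻¹ := ⟨x⁻¹, by simp⟩
    obtain ⟨h, hh⟩ : ∃ h, h = y⁻¹ * k * y := ⟨_, rfl⟩
    obtain ⟨f, hf⟩ : ∃ f, f = y⁻¹ * g * y := ⟨_, rfl⟩
    have conj : ∀ a b u : G, (a * b)⁻¹ * u * (a * b) = b⁻¹ * (a⁻¹ * u * a) * b := by
      intros; group
    have h1 : h⁻¹ * h * h = h := by group
    have h2 : k⁻¹ * k * k = k := by group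
    have hfh : h⁻¹ * f * h = f := by
      calc h⁻¹ * f * h = y⁻¹ * (k⁻¹ * g * k) * y := by rw [hh, hf]; group
        _ = f := by rw [hc, hf]
    have hhf : f⁻¹ * h * f = h := by
      calc f⁻¹ * h * f = y⁻¹ * (g⁻¹ * k * g) * y := by rw [hh, hf]; group
        _ = h := by rw [hc', hh]
    unfold etaFn dtwisted2 twisted3
    simp only [inv_inv, conj, ← hh, ← hf, hc, hc', h1, h2, hfh, hhf]
    apply Units.ext
    push_cast
    field_simp
end

section
/- Let G be a group and ω a normalized 4-cocycle on G. For x, a, b, c ∈ G define I^x(a,b,c) := ω(b, cx⁻¹, x, ax⁻¹) · ω(x, ax⁻¹, xbx⁻¹, xcx⁻¹) · (ω(a, b, cx⁻¹, x) · ω(cx⁻¹, x, ax⁻¹, xbx⁻¹))⁻¹. Then for all pairwise commuting a, b, c ∈ G (ab=ba, ac=ca, bc=cb) and every x ∈ G, I^x(a,b,c) · I^x(b,c,a) · I^x(c,a,b) · (I^x(a,c,b) · I^x(c,b,a) · I^x(b,a,c))⁻¹ = η^{a,b}(c,x)⁻¹ = β_{a,b}(x⁻¹, xcx⁻¹) ·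 β_{a,b}(c, x⁻¹)⁻¹. -/
/-- The quantity `I^x(a,b,c)` built from the 4-cocycle `ω`. -/
def Ifun {G : Type*} [Group G] (ω : G → G → G → G → ℂˣ) (x a b c : G) : ℂˣ :=
  ω b (c * x⁻¹) x (a * x⁻¹) * ω x (a * x⁻¹) (x * b * x⁻¹) (x * c * x⁻¹) *
    (ω a b (c * x⁻¹) x * ω (c * x⁻¹) x (a * x⁻¹) (x * b * x⁻¹))⁻¹

/-- For pairwise commuting `a, b, c` the alternating product of the `I^x`'s equals
`η^{a,b}(c,x)⁻¹ = β_{a,b}(x⁻¹, x c x⁻¹) · β_{a,b}(c, x⁻¹)⁻¹`. -/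
theorem Ifun_alternating_product_eq_eta_inv {G : Type*} [Group G]
    (ω : G → G → G → G → ℂˣ) (hω : IsNormalized4Cocycle ω)
    (a b c : G) (hab : a * b = b * a) (hac : a * c = c * a) (hbc : b * c = c * b)
    (x : G) :
    Ifun ω x a b c * Ifun ω x b c a * Ifun ω x c a b *
        (Ifun ω x a c b * Ifun ω x c b a * Ifun ω x b a c)⁻¹ = (etaFn ω a b c x)⁻¹ ∧
    (etaFn ω a b c x)⁻¹ =
      dtwisted2 ω a b x⁻¹ (x * c * x⁻¹) * (dtwisted2 ω a b c x⁻¹)⁻¹ := by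
  refine ⟨?_, by simp only [etaFn, mul_inv_rev, inv_inv]⟩
  obtain ⟨hc, hn⟩ := hω
  have n1 : ∀ g h k, ω 1 g h k = 1 := fun g h k => (hn g h k).1
  have n2 : ∀ g h k, ω g 1 h k = 1 := fun g h k => (hn g h k).2.1
  have n3 : ∀ g h k, ω g h 1 k = 1 := fun g h k => (hn g h k).2.2.1
  have n4 : ∀ g h k, ω g h k 1 = 1 := fun g h k => (hn g h k).2.2.2
  have sba : b * a = a * b := hab.symm
  have tba : ∀ z, b * (a * z) = a * (b * z) := fun z => by rw [← mul_assoc, sba, mul_assoc]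
  have iba : b⁻¹ * a = a * b⁻¹ :=
    (show Commute b a from hab.symm).inv_left.eq
  have jba : ∀ z, b⁻¹ * (a * z) = a * (b⁻¹ * z) := fun z => by rw [← mul_assoc, iba, mul_assoc]
  have iab : a⁻¹ * b = b * a⁻¹ :=
    (show Commute a b from hab).inv_left.eq
  have jab : ∀ z, a⁻¹ * (b * z) = b * (a⁻¹ * z) := fun z => by rw [← mul_assoc, iab, mul_assoc]
  have sca : c * a = a * c := hac.symm
  have tca : ∀ z, c * (a * z) = a * (c * z) := fun z => by rw [← mul_assoc, sca, mul_assoc]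
  have ica : c⁻¹ * a = a * c⁻¹ :=
    (show Commute c a from hac.symm).inv_left.eq
  have jca : ∀ z, c⁻¹ * (a * z) = a * (c⁻¹ * z) := fun z => by rw [← mul_assoc, ica, mul_assoc]
  have iac : a⁻¹ * c = c * a⁻¹ :=
    (show Commute a c from hac).inv_left.eq
  have jac : ∀ z, a⁻¹ * (c * z) = c * (a⁻¹ * z) := fun z => by rw [← mul_assoc, iac, mul_assoc]
  have scb : c * b = b * c := hbc.symm
  have tcb : ∀ z, c * (b * z) = b * (c * z) := fun z => by rw [← mul_assoc, scb, mul_assoc]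
  have icb : c⁻¹ * b = b * c⁻¹ :=
    (show Commute c b from hbc.symm).inv_left.eq
  have jcb : ∀ z, c⁻¹ * (b * z) = b * (c⁻¹ * z) := fun z => by rw [← mul_assoc, icb, mul_assoc]
  have ibc : b⁻¹ * c = c * b⁻¹ :=
    (show Commute b c from hbc).inv_left.eq
  have jbc : ∀ z, b⁻¹ * (c * z) = c * (b⁻¹ * z) := fun z => by rw [← mul_assoc, ibc, mul_assoc]
  have key : ∀ g₀ g₁ g₂ g₃ g₄ : G,
      Additive.ofMul (ω g₁ g₂ g₃ g₄) + Additive.ofMul (ω g₀ (g₁ * g₂) g₃ g₄)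
        + Additive.ofMul (ω g₀ g₁ g₂ (g₃ * g₄)) =
      Additive.ofMul (ω (g₀ * g₁) g₂ g₃ g₄) + Additive.ofMul (ω g₀ g₁ (g₂ * g₃) g₄)
        + Additive.ofMul (ω g₀ g₁ g₂ g₃) := fun g₀ g₁ g₂ g₃ g₄ =>
    congrArg Additive.ofMul (hc g₀ g₁ g₂ g₃ g₄)
  have h0 := key (x⁻¹) (x) (c * x⁻¹) (x * b * x⁻¹) (x * a * x⁻¹)
  have h1 := key (a) (x⁻¹) (x) (c * x⁻¹) (x * b * x⁻¹)
  have h2 := key (b) (a) (x⁻¹) (x) (c * x⁻¹)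
  have h3 := key (c) (b) (a) (x⁻¹) (x)
  have h4 := key (x⁻¹) (x) (c * x⁻¹) (x * a * x⁻¹) (x * b * x⁻¹)
  have h5 := key (b) (x⁻¹) (x) (c * x⁻¹) (x * a * x⁻¹)
  have h6 := key (a) (b) (x⁻¹) (x) (c * x⁻¹)
  have h7 := key (c) (a) (b) (x⁻¹) (x)
  have h8 := key (x⁻¹) (x) (a * x⁻¹) (x * c * x⁻¹) (x * b * x⁻¹)
  have h9 := key (b) (x⁻¹) (x) (a * x⁻¹) (x * c * x⁻¹)
  have h10 := key (c) (b) (x⁻¹) (x) (a * x⁻¹)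
  have h11 := key (a) (c) (b) (x⁻¹) (x)
  have h12 := key (x⁻¹) (x) (b * x⁻¹) (x * c * x⁻¹) (x * a * x⁻¹)
  have h13 := key (a) (x⁻¹) (x) (b * x⁻¹) (x * c * x⁻¹)
  have h14 := key (c) (a) (x⁻¹) (x) (b * x⁻¹)
  have h15 := key (b) (c) (a) (x⁻¹) (x)
  have h16 := key (x⁻¹) (x) (b * x⁻¹) (x * a * x⁻¹) (x * c * x⁻¹)
  have h17 := key (c) (x⁻¹) (x) (b * x⁻¹) (x * a * x⁻¹)
  have h18 := key (a) (c) (x⁻¹) (x) (b * x⁻¹)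
  have h19 := key (b) (a) (c) (x⁻¹) (x)
  have h20 := key (x⁻¹) (x) (a * x⁻¹) (x * b * x⁻¹) (x * c * x⁻¹)
  have h21 := key (c) (x⁻¹) (x) (a * x⁻¹) (x * b * x⁻¹)
  have h22 := key (b) (c) (x⁻¹) (x) (a * x⁻¹)
  have h23 := key (a) (b) (c) (x⁻¹) (x)
  apply Additive.ofMul.injective
  simp only [Ifun, etaFn, dtwisted2, twisted3, ofMul_mul, ofMul_inv]
  simp only [mul_assoc, mul_inv_rev, inv_inv, inv_mul_cancel_left, mul_inv_cancel_left,
    mul_inv_cancel, inv_mul_cancel, mul_one, one_mul,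
    sba, tba, iba, jba, iab, jab, sca, tca, ica, jca, iac, jac, scb, tcb, icb, jcb, ibc, jbc,
    n1, n2, n3, n4, ofMul_one] at h0 h1 h2 h3 h4 h5 h6 h7 h8 h9 h10 h11 h12 h13 h14 h15 h16 h17 h18 h19 h20 h21 h22 h23 ⊢
  clear key hc hn n1 n2 n3 n4 sba tba iba jba iab jab sca tca ica jca iac jac scb tcb icb jcb ibc jbc
  linear_combination (norm := module) - h0 - h1 - h2 - h3 + h4 + h5 + h6 + h7 - h8 - h9 - h10 - h11 + h12 + h13 + h14 + h15 - h16 - h17 - h18 - h19 + h20 + h21 + h22 + h23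
end

section
/- Let G be a group and ω a normalized 4-cocycle on G, with associated function η. Then for all pairwise commuting a, b, c ∈ G (ab=ba, ac=ca, bc=cb) and every x ∈ G: η^{a,b}(c,x) = η^{b,c}(a,x) = η^{c,a}(b,x) = η^{b,a}(c,x)⁻¹ = η^{c,b}(a,x)⁻¹ = η^{a,c}(b,x)⁻¹. -/
/-- Conjugation by an element commuting with `a` fixes `a`. -/
theorem conj_of_comm {G : Type*} [Group G] (a b : G) (h : a * b = b * a) :
    b⁻¹ * a * b = a := by
  rw [mul_assoc, h, inv_mul_cancel_left]

/-- The twisted 3-cocycle, with the conjugates of `u` named. -/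
theorem twisted3_eq {G : Type*} [Group G] (ω : G → G → G → G → ℂˣ) (u x y z u1 u2 u3 : G)
    (h1 : u * x = x * u1) (h2 : u1 * y = y * u2) (h3 : u2 * z = z * u3) :
    twisted3 ω u x y z =
      ω x u1 y z * ω x y z u3 * (ω u x y z * ω x y u2 z)⁻¹ := by
  have e1 : u1 = x⁻¹ * u * x := by rw [mul_assoc, h1, inv_mul_cancel_left]
  have e2 : u2 = y⁻¹ * u1 * y := by rw [mul_assoc, h2, inv_mul_cancel_left]
  have e3 : u3 = z⁻¹ * u2 * z := by rw [mul_assoc, h3, inv_mul_cancel_left]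
  subst e3 e2 e1
  unfold twisted3
  simp only [mul_inv_rev, mul_assoc]

/-- The doubly-twisted 2-cochain, with the conjugates of `w` named. -/
theorem dtwisted2_eq {G : Type*} [Group G] (ω : G → G → G → G → ℂˣ) (x w y z w1 w2 : G)
    (h1 : w * y = y * w1) (h2 : w1 * z = z * w2) :
    dtwisted2 ω x w y z =
      twisted3 ω x w y z * twisted3 ω x y z w2 * (twisted3 ω x y w1 z)⁻¹ := by
  have e1 : w1 = y⁻¹ * w * y := by rw [mul_assoc, h1, inv_mul_cancel_left]
  have e2 : w2 = z⁻¹ * w1 * z := by rw [mul_assoc, h2, inv_mul_cancel_left]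
  subst e2 e1
  unfold dtwisted2
  simp only [mul_inv_rev, mul_assoc]

/-- For commuting `a, b, c`, `η` is the signed product over the 24 orderings of `a, b, c, x⁻¹`,
where the letters to the right of `x⁻¹` are conjugated. -/
theorem etaFn_eq {G : Type*} [Group G] (ω : G → G → G → G → ℂˣ)
    (a b c x y a' b' c' : G) (hab : a * b = b * a) (hac : a * c = c * a) (hbc : b * c = c * b)
    (hy : y = x⁻¹) (ha : a' = x * a * x⁻¹) (hb : b' = x * b * x⁻¹) (hc : c' = x * c * x⁻¹) :
    etaFn ω a b c x =
      (ω b a c y * ω b c y a' * (ω a b c y * ω b c a y)⁻¹) *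
      (ω c a y b' * ω c y b' a' * (ω a c y b' * ω c y a' b')⁻¹) *
      (ω c a b y * ω c b y a' * (ω a c b y * ω c b a y)⁻¹)⁻¹ *
      ((ω b a y c' * ω b y c' a' * (ω a b y c' * ω b y a' c')⁻¹) *
      (ω y a' c' b' * ω y c' b' a' * (ω a y c' b' * ω y c' a' b')⁻¹) *
      (ω y a' b' c' * ω y b' c' a' * (ω a y b' c' * ω y b' a' c')⁻¹)⁻¹)⁻¹ := by
  have ya : a * y = y * a' := by subst hy ha; group
  have yb : b * y = y * b' := by subst hy hb; group
  have conj : ∀ g k : G, g * k = k * g →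
      (x * g * x⁻¹) * (x * k * x⁻¹) = (x * k * x⁻¹) * (x * g * x⁻¹) := by
    intro g k h
    have : ∀ g k : G, (x * g * x⁻¹) * (x * k * x⁻¹) = x * (g * k) * x⁻¹ := by
      intro g k; group
    rw [this, this, h]
  have hab' : a' * b' = b' * a' := by rw [ha, hb]; exact conj _ _ hab
  have hac' : a' * c' = c' * a' := by rw [ha, hc]; exact conj _ _ hac
  have hbc' : b' * c' = c' * b' := by rw [hb, hc]; exact conj _ _ hbc
  unfold etaFn
  rw [← hc, ← hy, dtwisted2_eq ω a b c y b b' hbc yb, dtwisted2_eq ω a b y c' b' b' yb hbc',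
    twisted3_eq ω a b c y a a a' hab hac ya, twisted3_eq ω a c y b' a a' a' hac ya hab',
    twisted3_eq ω a c b y a a a' hac hab ya, twisted3_eq ω a b y c' a a' a' hab ya hac',
    twisted3_eq ω a y c' b' a' a' a' ya hac' hab', twisted3_eq ω a y b' c' a' a' a' ya hab' hac']

/-- For pairwise commuting `a, b, c`:
`η^{a,b}(c,x) = η^{b,c}(a,x) = η^{c,a}(b,x) = η^{b,a}(c,x)⁻¹ = η^{c,b}(a,x)⁻¹ = η^{a,c}(b,x)⁻¹`. -/
theorem etaFn_cyclic_and_antisymmetric {G : Type*} [Group G]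
    (ω : G → G → G → G → ℂˣ) (hω : IsNormalized4Cocycle ω)
    (a b c : G) (hab : a * b = b * a) (hac : a * c = c * a) (hbc : b * c = c * b)
    (x : G) :
    etaFn ω a b c x = etaFn ω b c a x ∧
    etaFn ω a b c x = etaFn ω c a b x ∧
    etaFn ω a b c x = (etaFn ω b a c x)⁻¹ ∧
    etaFn ω a b c x = (etaFn ω c b a x)⁻¹ ∧
    etaFn ω a b c x = (etaFn ω a c b x)⁻¹ := by
  rw [etaFn_eq ω a b c x _ _ _ _ hab hac hbc rfl rfl rfl rfl,
    etaFn_eq ω b c a x _ _ _ _ hbc hab.symm hac.symm rfl rfl rfl rfl,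
    etaFn_eq ω c a b x _ _ _ _ hac.symm hbc.symm hab rfl rfl rfl rfl,
    etaFn_eq ω b a c x _ _ _ _ hab.symm hbc hac rfl rfl rfl rfl,
    etaFn_eq ω c b a x _ _ _ _ hbc.symm hac.symm hab.symm rfl rfl rfl rfl,
    etaFn_eq ω a c b x _ _ _ _ hac hab hbc.symm rfl rfl rfl rfl]
  generalize x * a * x⁻¹ = a', x * b * x⁻¹ = b', x * c * x⁻¹ = c', x⁻¹ = y
  simp only [mul_inv, inv_inv]
  refine ⟨?_, ?_, ?_, ?_, ?_⟩ <;> ac_rfl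
end

section
/- Let G be a group and β a normalized family of doubly-twisted 2-cocycles on G. Then for all k, g ∈ G with kg = gk, all h₁, h₂ ∈ Z_{k,g}, and all x ∈ G: η^{k,g}(h₁h₂, x) · (η^{k,g}(h₁, x) · η^{k,g}(h₂, x))⁻¹ = β_{xkx⁻¹, xgx⁻¹}(xh₁x⁻¹, xh₂x⁻¹) · β_{k,g}(h₁, h₂)⁻¹. -/
/-- A normalized family of doubly-twisted 2-cocycles on a group `G`:
`β a b` is normalized in each slot, and satisfies the doubly-twisted 2-cocycle
condition whenever the two twisting elements commute. -/
def IsDT2Family {G : Type*} [Group G] (β : G → G → G → G → ℂˣ) : Prop :=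
  (∀ a b y z : G, β a b 1 z = 1 ∧ β a b y 1 = 1) ∧
  (∀ a b : G, a * b = b * a → ∀ x y z : G,
    β (x⁻¹ * a * x) (x⁻¹ * b * x) y z * β a b x (y * z) = β a b (x * y) z * β a b x y)

/-- The function `η^{a,b}(c,x) = β_{a,b}(c,x⁻¹) · β_{a,b}(x⁻¹, x c x⁻¹)⁻¹`. -/
def etaOf {G : Type*} [Group G] (β : G → G → G → G → ℂˣ) (a b c x : G) : ℂˣ :=
  β a b c x⁻¹ * (β a b x⁻¹ (x * c * x⁻¹))⁻¹

/-- The defect of multiplicativity of `η^{k,g}(·,x)` on `Z_{k,g}` is the ratio of the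
conjugated and original doubly-twisted 2-cocycles. -/
theorem etaOf_mul_defect {G : Type*} [Group G]
    (β : G → G → G → G → ℂˣ) (hβ : IsDT2Family β)
    (k g : G) (hkg : k * g = g * k)
    (h₁ : G) (hh₁ : h₁ * k = k * h₁ ∧ h₁ * g = g * h₁)
    (h₂ : G) (hh₂ : h₂ * k = k * h₂ ∧ h₂ * g = g * h₂)
    (x : G) :
    etaOf β k g (h₁ * h₂) x * (etaOf β k g h₁ x * etaOf β k g h₂ x)⁻¹ =
      β (x * k * x⁻¹) (x * g * x⁻¹) (x * h₁ * x⁻¹) (x * h₂ * x⁻¹) * (β k g h₁ h₂)⁻¹ := by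
  obtain ⟨-, hc⟩ := hβ
  have c1 : h₁⁻¹ * k * h₁ = k := by rw [mul_assoc, ← hh₁.1, inv_mul_cancel_left]
  have c2 : h₁⁻¹ * g * h₁ = g := by rw [mul_assoc, ← hh₁.2, inv_mul_cancel_left]
  have e1 := hc k g hkg h₁ h₂ x⁻¹
  have e2 := hc k g hkg h₁ x⁻¹ (x * h₂ * x⁻¹)
  have e3 := hc k g hkg x⁻¹ (x * h₁ * x⁻¹) (x * h₂ * x⁻¹)
  rw [c1, c2] at e1 e2
  have m1 : x⁻¹ * (x * h₂ * x⁻¹) = h₂ * x⁻¹ := by group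
  have m2 : x⁻¹ * (x * h₁ * x⁻¹) = h₁ * x⁻¹ := by group
  have m3 : x * h₁ * x⁻¹ * (x * h₂ * x⁻¹) = x * (h₁ * h₂) * x⁻¹ := by group
  rw [m1] at e2
  rw [m2, m3, inv_inv] at e3
  unfold etaOf
  generalize β (x * k * x⁻¹) (x * g * x⁻¹) (x * h₁ * x⁻¹) (x * h₂ * x⁻¹) = A at *
  generalize β k g h₁ h₂ = B at *
  generalize β k g (h₁ * h₂) x⁻¹ = C at *
  generalize β k g h₁ (h₂ * x⁻¹) = D at *
  generalize β k g (h₁ * x⁻¹) (x * h₂ * x⁻¹) = E at *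
  generalize β k g x⁻¹ (x * (h₁ * h₂) * x⁻¹) = F at *
  generalize β k g x⁻¹ (x * h₁ * x⁻¹) = P at *
  generalize β k g x⁻¹ (x * h₂ * x⁻¹) = Q at *
  generalize β k g h₁ x⁻¹ = R at *
  generalize β k g h₂ x⁻¹ = S at *
  have hC : C = S * D * B⁻¹ := eq_mul_inv_of_mul_eq e1.symm
  have hE : E = Q * D * R⁻¹ := eq_mul_inv_of_mul_eq e2.symm
  have hA : A = E * P * F⁻¹ := eq_mul_inv_of_mul_eq e3
  rw [hA, hE, hC]
  apply Units.ext
  push_cast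
  field_simp
end

section
/- Let G be a group and β a normalized family of doubly-twisted 2-cocycles on G. Then for all k, g ∈ G with kg = gk and every h ∈ Z_{k,g}, the map x ↦ η^{k,g}(h,x) is multiplicative on Z_{k,g,h}: for all x, y ∈ Z_{k,g,h}, η^{k,g}(h,x) · η^{k,g}(h,y) = η^{k,g}(h,xy), and η^{k,g}(h,1) = 1; that is, it defines a one-dimensional representation (a group homomorphism Z_{k,g,h} → ℂˣ). -/
theorem units_aux (a b c d e f p q r : ℂˣ) (h1 : p * e = q * c) (h2 : a * r = q * d)
    (h3 : b * r = f * p) : a * b⁻¹ * (c * d⁻¹) = e * f⁻¹ := by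
  have he : e = p⁻¹ * (q * c) := by rw [← h1]; simp
  have hf : f = b * r * p⁻¹ := by rw [h3]; simp
  have ha : a = q * d * r⁻¹ := by rw [← h2]; simp
  subst he hf ha
  ext
  push_cast
  field_simp

/-- For `kg = gk` and `h ∈ Z_{k,g}`, the map `x ↦ η^{k,g}(h,x)` is multiplicative on
`Z_{k,g,h}` and sends `1` to `1`: it defines a one-dimensional representation of
`Z_{k,g,h}`. -/
theorem etaOf_one_dimensional_rep {G : Type*} [Group G]
    (β : G → G → G → G → ℂˣ) (hβ : IsDT2Family β)
    (k g : G) (hkg : k * g = g * k)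
    (h : G) (hh : h * k = k * h ∧ h * g = g * h) :
    (∀ x y : G,
      (x * k = k * x ∧ x * g = g * x ∧ x * h = h * x) →
      (y * k = k * y ∧ y * g = g * y ∧ y * h = h * y) →
      etaOf β k g h x * etaOf β k g h y = etaOf β k g h (x * y)) ∧
    etaOf β k g h 1 = 1 := by
  obtain ⟨hn, hc⟩ := hβ
  have key : ∀ x : G, x * k = k * x → x * g = g * x → ∀ y z : G,
      β k g y z * β k g x (y * z) = β k g (x * y) z * β k g x y := by
    intro x hk hg y z
    have := hc k g hkg x y z
    rwa [mul_assoc, ← hk, inv_mul_cancel_left, mul_assoc, ← hg, inv_mul_cancel_left] at this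
  have cinv : ∀ x z : G, x * z = z * x → x⁻¹ * z = z * x⁻¹ := fun x z e =>
    (Commute.inv_left (show Commute x z from e)).eq
  refine ⟨?_, by simp [etaOf, (hn k g h h).1, (hn k g h h).2]⟩
  rintro x y ⟨xk, xg, xh⟩ ⟨yk, yg, yh⟩
  have xyh : x * y * h = h * (x * y) := by rw [mul_assoc, yh, ← mul_assoc, xh, mul_assoc]
  unfold etaOf
  rw [xh, yh, xyh, mul_inv_cancel_right, mul_inv_cancel_right, mul_inv_cancel_right, mul_inv_rev]
  have e1 := key h hh.1 hh.2 y⁻¹ x⁻¹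
  have e2 := key y⁻¹ (cinv _ _ yk) (cinv _ _ yg) h x⁻¹
  have e3 := key y⁻¹ (cinv _ _ yk) (cinv _ _ yg) x⁻¹ h
  rw [cinv y h yh] at e2
  rw [cinv x h xh] at e3
  exact units_aux _ _ _ _ _ _ _ _ _ e1 e2 e3
end

section
/- Let G be a finite group and β a normalized family of doubly-twisted 2-cocycles on G. Then for all k, g ∈ G with kg = gk and every h ∈ Z_{k,g}: (1/|Z_{k,g,h}|) · Σ_{x ∈ Z_{k,g,h}} η^{k,g}(h,x) equals 1 if h is β_{k,g}-regular, and equals 0 otherwise. -/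
/-- Multiplicativity of `d ↦ β(h,d) β(d,h)⁻¹` on the common centralizer. -/
lemma chi_mul_aux {G : Type*} [Group G] (β : G → G → G → G → ℂˣ) (hβ : IsDT2Family β)
    (k g : G) (hkg : k * g = g * k) (h : G) (hh : h * k = k * h ∧ h * g = g * h) (x y : G)
    (hx : x * k = k * x ∧ x * g = g * x ∧ x * h = h * x) (hy : y * h = h * y) :
    β k g h (x * y) * (β k g (x * y) h)⁻¹ =
      (β k g h x * (β k g x h)⁻¹) * (β k g h y * (β k g y h)⁻¹) := by
  have conj : ∀ u v : G, u * v = v * u → u⁻¹ * v * u = v := by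
    intro u v huv
    rw [mul_assoc, ← huv, inv_mul_cancel_left]
  have h1 := hβ.2 k g hkg h x y
  have h2 := hβ.2 k g hkg x h y
  have h3 := hβ.2 k g hkg x y h
  rw [conj _ _ hh.1, conj _ _ hh.2] at h1
  rw [conj _ _ hx.1, conj _ _ hx.2.1] at h2 h3
  rw [hx.2.2] at h2
  rw [hy] at h3
  rw [Units.ext_iff] at h1 h2 h3 ⊢
  push_cast at h1 h2 h3 ⊢
  have n1 := (β k g (x * y) h).ne_zero
  have n2 := (β k g x h).ne_zero
  have n3 := (β k g y h).ne_zero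
  have n4 := (β k g x y).ne_zero
  have n5 := (β k g x (h * y)).ne_zero
  field_simp
  apply mul_left_cancel₀ (mul_ne_zero n4 n5)
  linear_combination (β k g x (h * y) * β k g x h * β k g y h : ℂ) * h1
    - (β k g h x * β k g x (h * y) * β k g y h : ℂ) * h2
    + (β k g h x * β k g h y * β k g x (h * y) : ℂ) * h3

lemma eta_eq_aux {G : Type*} [Group G] (β : G → G → G → G → ℂˣ) (k g h x : G)
    (hx : x * h = h * x) :
    etaOf β k g h x = β k g h x⁻¹ * (β k g x⁻¹ h)⁻¹ := by
  unfold etaOf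
  rw [hx, mul_inv_cancel_right]

/-- The averaged sum of `η^{k,g}(h,·)` over `Z_{k,g,h}` is `1` if `h` is `β_{k,g}`-regular
and `0` otherwise. -/
theorem etaOf_average_eq_regular_indicator {G : Type*} [Group G] [Fintype G] [DecidableEq G]
    (β : G → G → G → G → ℂˣ) (hβ : IsDT2Family β)
    (k g : G) (hkg : k * g = g * k)
    (h : G) (hh : h * k = k * h ∧ h * g = g * h) :
    ((∀ d : G, (d * k = k * d ∧ d * g = g * d ∧ d * h = h * d) →
        β k g h d = β k g d h) →
      (((Finset.univ.filter
          (fun x : G => x * k = k * x ∧ x * g = g * x ∧ x * h = h * x)).card : ℂ))⁻¹ *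
        ∑ x ∈ Finset.univ.filter
            (fun x : G => x * k = k * x ∧ x * g = g * x ∧ x * h = h * x),
          ((etaOf β k g h x : ℂˣ) : ℂ) = 1) ∧
    (¬ (∀ d : G, (d * k = k * d ∧ d * g = g * d ∧ d * h = h * d) →
        β k g h d = β k g d h) →
      (((Finset.univ.filter
          (fun x : G => x * k = k * x ∧ x * g = g * x ∧ x * h = h * x)).card : ℂ))⁻¹ *
        ∑ x ∈ Finset.univ.filter
            (fun x : G => x * k = k * x ∧ x * g = g * x ∧ x * h = h * x),
          ((etaOf β k g h x : ℂˣ) : ℂ) = 0) := by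
  classical
  have inv_comm : ∀ u v : G, u * v = v * u → u⁻¹ * v = v * u⁻¹ := by
    intro u v huv
    exact (Commute.inv_left (show Commute u v from huv)).eq
  have mul_comm' : ∀ u w v : G, u * v = v * u → w * v = v * w → u * w * v = v * (u * w) := by
    intro u w v hu hw
    exact (Commute.mul_left (show Commute u v from hu) (show Commute w v from hw)).eq
  constructor
  · intro hreg
    rw [Finset.sum_congr rfl (g := fun _ => (1 : ℂ))]
    · rw [Finset.sum_const, nsmul_eq_mul, mul_one, inv_mul_cancel₀]
      rw [Nat.cast_ne_zero]
      apply Finset.card_ne_zero_of_mem (a := 1)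
      simp
    · intro x hx
      rw [Finset.mem_filter] at hx
      obtain ⟨-, hx1, hx2, hx3⟩ := hx
      rw [eta_eq_aux β k g h x hx3,
        hreg x⁻¹ ⟨inv_comm _ _ hx1, inv_comm _ _ hx2, inv_comm _ _ hx3⟩, mul_inv_cancel,
        Units.val_one]
  · intro hreg
    push Not at hreg
    obtain ⟨d, ⟨hd1, hd2, hd3⟩, hd⟩ := hreg
    set S := Finset.univ.filter (fun x : G => x * k = k * x ∧ x * g = g * x ∧ x * h = h * x)
      with hS
    have key : ∑ x ∈ S, ((etaOf β k g h x : ℂˣ) : ℂ) =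
        ∑ x ∈ S, ((etaOf β k g h x : ℂˣ) : ℂ) * ((β k g h d * (β k g d h)⁻¹ : ℂˣ) : ℂ) := by
      symm
      refine Finset.sum_bij' (fun x _ => d⁻¹ * x) (fun x _ => d * x) ?_ ?_ ?_ ?_ ?_
      · intro x hx
        simp only [hS, Finset.mem_filter, Finset.mem_univ, true_and] at hx ⊢
        exact ⟨mul_comm' _ _ _ (inv_comm _ _ hd1) hx.1,
          mul_comm' _ _ _ (inv_comm _ _ hd2) hx.2.1, mul_comm' _ _ _ (inv_comm _ _ hd3) hx.2.2⟩
      · intro x hx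
        simp only [hS, Finset.mem_filter, Finset.mem_univ, true_and] at hx ⊢
        exact ⟨mul_comm' _ _ _ hd1 hx.1, mul_comm' _ _ _ hd2 hx.2.1, mul_comm' _ _ _ hd3 hx.2.2⟩
      · intro x _
        simp
      · intro x _
        simp
      · intro x hx
        simp only [hS, Finset.mem_filter, Finset.mem_univ, true_and] at hx
        obtain ⟨hx1, hx2, hx3⟩ := hx
        rw [eta_eq_aux β k g h x hx3, eta_eq_aux β k g h (d⁻¹ * x)
          (mul_comm' _ _ _ (inv_comm _ _ hd3) hx3), ← Units.val_mul, mul_inv_rev, inv_inv,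
          chi_mul_aux β hβ k g hkg h hh x⁻¹ d
            ⟨inv_comm _ _ hx1, inv_comm _ _ hx2, inv_comm _ _ hx3⟩ hd3]
    rw [← Finset.sum_mul] at key
    have hne : ((β k g h d * (β k g d h)⁻¹ : ℂˣ) : ℂ) ≠ 1 := by
      intro he
      exact hd (mul_inv_eq_one.mp (Units.ext he))
    have hz : ∑ x ∈ S, ((etaOf β k g h x : ℂˣ) : ℂ) = 0 := by
      by_contra hnz
      exact hne (mul_left_cancel₀ hnz (by rw [mul_one]; exact key.symm))
    rw [hz, mul_zero]
end

section
/- Let G be a group and β a normalized family of doubly-twisted 2-cocycles on G, and let a, b ∈ G with ab = ba. Then an element c ∈ Z_{a,b} is β_{a,b}-regular if and only if every conjugate y c y⁻¹ with y ∈ Z_{a,b} is β_{a,b}-regular; equivalently, c is β_{a,b}-regular if and only if its entire conjugacy class within the group Z_{a,b} consists of β_{a,b}-regular elements. -/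
/-- `β_{a,b}`-regularity is a property of the conjugacy class within `Z_{a,b}`:
`c ∈ Z_{a,b}` is `β_{a,b}`-regular iff every conjugate `y c y⁻¹` with `y ∈ Z_{a,b}` is. -/
theorem betaRegular_iff_conjugates_regular {G : Type*} [Group G]
    (β : G → G → G → G → ℂˣ) (hβ : IsDT2Family β)
    (a b : G) (hab : a * b = b * a)
    (c : G) (hc : c * a = a * c ∧ c * b = b * c) :
    (∀ d : G, (d * a = a * d ∧ d * b = b * d ∧ d * c = c * d) →
        β a b c d = β a b d c) ↔
    (∀ y : G, y * a = a * y → y * b = b * y →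
      ∀ d : G, (d * a = a * d ∧ d * b = b * d ∧ d * (y * c * y⁻¹) = (y * c * y⁻¹) * d) →
        β a b (y * c * y⁻¹) d = β a b d (y * c * y⁻¹)) := by
  constructor
  · intro h y hya hyb d ⟨hda, hdb, hdc⟩
    have key : ∀ x : G, x * a = a * x → x * b = b * x → ∀ u v : G,
        β a b u v * β a b x (u * v) = β a b (x * u) v * β a b x u := by
      intro x hxa hxb u v
      have := hβ.2 a b hab x u v
      rwa [mul_assoc x⁻¹ a, ← hxa, inv_mul_cancel_left, mul_assoc x⁻¹ b, ← hxb,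
        inv_mul_cancel_left] at this
    have hyS : Commute y a ∧ Commute y b := ⟨hya, hyb⟩
    have hdS : Commute d a ∧ Commute d b := ⟨hda, hdb⟩
    have hcS : Commute c a ∧ Commute c b := hc
    have hCa : Commute (y * c * y⁻¹) a :=
      (hyS.1.mul_left hcS.1).mul_left hyS.1.inv_left
    have hCb : Commute (y * c * y⁻¹) b :=
      (hyS.2.mul_left hcS.2).mul_left hyS.2.inv_left
    obtain ⟨e, he⟩ : ∃ e, e = y⁻¹ * d * y := ⟨_, rfl⟩
    have hea : Commute e a := he ▸ (hyS.1.inv_left.mul_left hdS.1).mul_left hyS.1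
    have heb : Commute e b := he ▸ (hyS.2.inv_left.mul_left hdS.2).mul_left hyS.2
    have hdy : d * y = y * e := by rw [he]; group
    obtain ⟨C, hC⟩ : ∃ C, C = y * c * y⁻¹ := ⟨_, rfl⟩
    have hCy : C * y = y * c := by rw [hC]; group
    rw [← hC] at hCa hCb hdc ⊢
    have hec : e * c = c * e := by
      apply mul_left_cancel (a := y)
      rw [← mul_assoc, ← hdy, mul_assoc, ← hCy, ← mul_assoc, hdc, mul_assoc, hdy,
        ← mul_assoc, hCy, mul_assoc]
    have hr := h e ⟨hea, heb, hec⟩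
    have h1 := key C hCa hCb d y
    have h2 := key d hda hdb C y
    have h3 := key C hCa hCb y e
    have h4 := key d hda hdb y c
    have h5 := key y hya hyb c e
    have h6 := key y hya hyb e c
    rw [hdy] at h1 h4
    rw [hCy] at h2 h3
    rw [hdc] at h2
    rw [hec, ← hr] at h6
    rw [h5] at h6
    apply mul_left_cancel (a := β a b (C * d) y * (β a b y e * β a b y c))
    calc _ = (β a b (C * d) y * β a b C d) * (β a b y e * β a b y c) := by
            simp only [mul_comm, mul_left_comm]
      _ = β a b d y * β a b y c * (β a b y e * β a b C (y * e)) := by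
            rw [← h1]; simp only [mul_comm, mul_left_comm]
      _ = β a b d y * β a b C y * (β a b (y * c) e * β a b y c) := by
            rw [h3]; simp only [mul_comm, mul_left_comm]
      _ = β a b C y * β a b y e * (β a b (y * e) c * β a b d y) := by
            rw [h6]; simp only [mul_comm, mul_left_comm]
      _ = (β a b C y * β a b d (y * c)) * (β a b y e * β a b y c) := by
            rw [← h4]; simp only [mul_comm, mul_left_comm]
      _ = _ := by
            rw [h2]; simp only [mul_comm, mul_left_comm]
  · intro h d hd
    simpa using h 1 (by simp) (by simp) d (by simpa using hd)
end

section
/- Let G be a group, β a normalized family of doubly-twisted 2-cocycles on G, k, g ∈ G with kg = gk, and x ∈ G. Let V be a complex vector space and ρ : Z_{k,g} → End(V) a β_{k,g}-representation, i.e. ρ(h₁) ∘ ρ(h₂) = β_{k,g}(h₁,h₂) • ρ(h₁h₂) for all h₁, h₂ ∈ Z_{k,g}. Define ρ' on Z_{k,g} by ρ'(h) := η^{k,g}(h,x)⁻¹ • ρ(h). Then for all h₁, h₂ ∈ Z_{k,g}: ρ'(h₁) ∘ ρ'(h₂) = β_{xkx⁻¹, xgx⁻¹}(xh₁x⁻¹,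 xh₂x⁻¹) • ρ'(h₁h₂); that is, h' ↦ η^{k,g}(x⁻¹h'x, x)⁻¹ • ρ(x⁻¹h'x) is a β_{xkx⁻¹,xgx⁻¹}-representation of the conjugate subgroup x Z_{k,g} x⁻¹ = Z_{xkx⁻¹, xgx⁻¹}. -/
/-- Twisting a `β_{k,g}`-representation of `Z_{k,g}` by `η^{k,g}(·,x)⁻¹` yields a
`β_{xkx⁻¹,xgx⁻¹}`-representation: the twisted operators satisfy the conjugated
projective multiplication rule. -/
theorem eta_twisted_rep_is_conjugated_beta_rep {G : Type*} [Group G]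
    (β : G → G → G → G → ℂˣ) (hβ : IsDT2Family β)
    (k g : G) (hkg : k * g = g * k) (x : G)
    (V : Type*) [AddCommGroup V] [Module ℂ V]
    (ρ : G → Module.End ℂ V)
    (hρ : ∀ h₁ h₂ : G,
      (h₁ * k = k * h₁ ∧ h₁ * g = g * h₁) →
      (h₂ * k = k * h₂ ∧ h₂ * g = g * h₂) →
      ρ h₁ * ρ h₂ = ((β k g h₁ h₂ : ℂˣ) : ℂ) • ρ (h₁ * h₂)) :
    ∀ h₁ h₂ : G,
      (h₁ * k = k * h₁ ∧ h₁ * g = g * h₁) →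
      (h₂ * k = k * h₂ ∧ h₂ * g = g * h₂) →
      ((((etaOf β k g h₁ x)⁻¹ : ℂˣ) : ℂ) • ρ h₁) *
          ((((etaOf β k g h₂ x)⁻¹ : ℂˣ) : ℂ) • ρ h₂) =
        ((β (x * k * x⁻¹) (x * g * x⁻¹) (x * h₁ * x⁻¹) (x * h₂ * x⁻¹) : ℂˣ) : ℂ) •
          ((((etaOf β k g (h₁ * h₂) x)⁻¹ : ℂˣ) : ℂ) • ρ (h₁ * h₂)) := by
  intro h₁ h₂ H₁ H₂
  have e1 := hβ.2 k g hkg x⁻¹ (x * h₁ * x⁻¹) (x * h₂ * x⁻¹)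
  have e2 := hβ.2 k g hkg h₁ x⁻¹ (x * h₂ * x⁻¹)
  have e3 := hβ.2 k g hkg h₁ h₂ x⁻¹
  have ck : h₁⁻¹ * k * h₁ = k := by rw [mul_assoc, ← H₁.1, inv_mul_cancel_left]
  have cg : h₁⁻¹ * g * h₁ = g := by rw [mul_assoc, ← H₁.2, inv_mul_cancel_left]
  have a1 : x⁻¹ * (x * h₁ * x⁻¹) = h₁ * x⁻¹ := by group
  have a2 : x⁻¹ * (x * h₂ * x⁻¹) = h₂ * x⁻¹ := by group
  have a3 : (x * h₁ * x⁻¹) * (x * h₂ * x⁻¹) = x * (h₁ * h₂) * x⁻¹ := by group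
  rw [inv_inv, a1, a3] at e1
  rw [ck, cg, a2] at e2
  rw [ck, cg] at e3
  have key : (etaOf β k g h₁ x)⁻¹ * (etaOf β k g h₂ x)⁻¹ * β k g h₁ h₂ =
      β (x * k * x⁻¹) (x * g * x⁻¹) (x * h₁ * x⁻¹) (x * h₂ * x⁻¹) *
        (etaOf β k g (h₁ * h₂) x)⁻¹ := by
    have f1 := eq_mul_inv_of_mul_eq e1
    have f2 := eq_mul_inv_of_mul_eq e2.symm
    have f3 := eq_mul_inv_of_mul_eq ((mul_comm _ _).trans e3)
    rw [f1, f2, f3]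
    unfold etaOf
    apply Units.ext
    push_cast
    field_simp
  rw [smul_mul_smul_comm, hρ h₁ h₂ H₁ H₂, smul_smul, smul_smul]
  congr 1
  exact_mod_cast congrArg Units.val key
end

section
/- Let H be a group, β : H×H → ℂˣ, V a finite-dimensional complex vector space, and ρ : H → End(V) a projective β-representation (ρ(1) = id and ρ(x) ∘ ρ(y) = β(x,y) • ρ(xy) for all x, y ∈ H). If h ∈ H is not β-regular, in the sense that there exists l ∈ H with hl = lh and β(h,l) ≠ β(l,h), then the projective character vanishes at h: trace ρ(h) = 0. -/
/-- The projective character of a projective `β`-representation vanishes at any element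
`h` that is not `β`-regular, i.e. for which some commuting `l` has `β(h,l) ≠ β(l,h)`. -/
theorem projective_character_eq_zero_of_not_regular {H : Type*} [Group H]
    (β : H → H → ℂˣ)
    (V : Type*) [AddCommGroup V] [Module ℂ V] [FiniteDimensional ℂ V]
    (ρ : H → Module.End ℂ V) (hρ1 : ρ 1 = 1)
    (hρ : ∀ x y : H, ρ x * ρ y = ((β x y : ℂˣ) : ℂ) • ρ (x * y))
    (h : H) (hirreg : ∃ l : H, h * l = l * h ∧ β h l ≠ β l h) :
    LinearMap.trace ℂ V (ρ h) = 0 := by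
  obtain ⟨l, hl, hne⟩ := hirreg
  have h1 : ρ l * (((β l l⁻¹ : ℂˣ) : ℂ)⁻¹ • ρ l⁻¹) = 1 := by
    rw [mul_smul_comm, hρ, smul_smul, inv_mul_cancel₀ (Units.ne_zero _), one_smul,
      mul_inv_cancel, hρ1]
  generalize ((β l l⁻¹ : ℂˣ) : ℂ)⁻¹ • ρ l⁻¹ = S at h1
  have h2 : S * ρ l = 1 := mul_eq_one_comm.mp h1
  have e : ((β l h : ℂˣ) : ℂ) • (ρ h * ρ l) = ((β h l : ℂˣ) : ℂ) • (ρ l * ρ h) := by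
    rw [hρ, hρ, hl, smul_smul, smul_smul, mul_comm]
  have e2 := congrArg (fun T => LinearMap.trace ℂ V (T * S)) e
  simp only [smul_mul_assoc, map_smul, smul_eq_mul] at e2
  rw [mul_assoc (ρ h), h1, mul_one, LinearMap.trace_mul_comm ℂ (ρ l * ρ h) S, ← mul_assoc, h2,
    one_mul] at e2
  by_contra ht
  exact hne (Units.ext (mul_right_cancel₀ ht e2).symm)
end

section
/- Let H be a group, β : H×H → ℂˣ with β(1,y) = β(x,1) = 1 for all x, y ∈ H, V a nonzero complex vector space, and ρ : H → End(V) a projective β-representation. Let g ∈ H have finite order p (p = orderOf g, so g^p = 1), and suppose ρ(g) = θ • id for some scalar θ ∈ ℂ. Then θ^p = ∏_{n=0}^{p−1} β(g, g^n). (In the paper this says that the topological spin θ^{A,B}_μ is a p_B-th root of the class function α_{AB} = ∏_{n=0}^{p_B−1} β_{k^A,g^B}(g^B, (g^B)^n).) -/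
/-- If `ρ(g) = θ • id` in a projective `β`-representation with normalized `β`, and `g`
has finite order `p`, then `θ^p = ∏_{n=0}^{p-1} β(g, gⁿ)`: the scalar `θ` is a `p`-th
root of the class function `α = ∏_{n} β(g, gⁿ)`. -/
theorem scalar_power_eq_prod_beta {H : Type*} [Group H]
    (β : H → H → ℂˣ) (hβnorm : ∀ x y : H, β 1 y = 1 ∧ β x 1 = 1)
    (V : Type*) [AddCommGroup V] [Module ℂ V] [Nontrivial V]
    (ρ : H → Module.End ℂ V) (hρ1 : ρ 1 = 1)
    (hρ : ∀ x y : H, ρ x * ρ y = ((β x y : ℂˣ) : ℂ) • ρ (x * y))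
    (g : H) (hg : IsOfFinOrder g) (p : ℕ) (hp : p = orderOf g)
    (θ : ℂ) (hθ : ρ g = θ • (1 : Module.End ℂ V)) :
    θ ^ p = ∏ n ∈ Finset.range p, ((β g (g ^ n) : ℂˣ) : ℂ) := by
  have key : ∀ k : ℕ, (θ ^ k) • (1 : Module.End ℂ V)
      = (∏ n ∈ Finset.range k, ((β g (g ^ n) : ℂˣ) : ℂ)) • ρ (g ^ k) := by
    intro k
    induction k with
    | zero => simp [hρ1]
    | succ k ih =>
      have h : θ • ρ (g ^ k) = ((β g (g ^ k) : ℂˣ) : ℂ) • ρ (g ^ (k + 1)) := by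
        rw [pow_succ', ← hρ, hθ, smul_mul_assoc, one_mul]
      rw [Finset.prod_range_succ, mul_smul, ← h, smul_comm, ← ih, smul_smul, pow_succ']
  have h := key p
  have hgp : g ^ p = 1 := by rw [hp]; exact pow_orderOf_eq_one g
  rw [hgp, hρ1] at h
  exact smul_left_injective ℂ (one_ne_zero : (1 : Module.End ℂ V) ≠ 0) h
end

section
/- Let G be a group, α a normalized 3-cochain on G, and ω := δα its coboundary. Let [b,c,d]_a denote the twisted 3-cocycle of ω, and define β_a(x,y) := α(a,x,y) · α(x,y,(xy)⁻¹a(xy)) · α(x, x⁻¹ax, y)⁻¹. Then the twisted 3-cocycle of ω is the twisted coboundary of β: for all a, b, c, d ∈ G, [b,c,d]_a = β_{b⁻¹ab}(c,d) · β_a(b,cd) · (β_a(bc,d) · β_a(b,c))⁻¹. -/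
/-- The coboundary `δα` of a 3-cochain `α`. -/
def delta3 {G : Type*} [Group G] (α : G → G → G → ℂˣ) (a b c d : G) : ℂˣ :=
  α b c d * α a (b * c) d * α a b c * (α (a * b) c d * α a b (c * d))⁻¹

/-- The twisted 2-cochain `β_a(x,y)` obtained from a 3-cochain `α` by the slant product. -/
def betaSlant {G : Type*} [Group G] (α : G → G → G → ℂˣ) (a x y : G) : ℂˣ :=
  α a x y * α x y ((x * y)⁻¹ * a * (x * y)) * (α x (x⁻¹ * a * x) y)⁻¹

/-- The doubly-twisted 1-cochain `ε_{a,b}(x) = β_a(x, x⁻¹bx) · β_a(b,x)⁻¹`. -/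
def epsSlant {G : Type*} [Group G] (α : G → G → G → ℂˣ) (a b x : G) : ℂˣ :=
  betaSlant α a x (x⁻¹ * b * x) * (betaSlant α a b x)⁻¹

/-- When `ω = δα` is a coboundary, the twisted 3-cocycle of `ω` is the twisted coboundary
of the slant product `β_a` of `α`. -/
theorem twisted3_of_coboundary_eq_twisted_coboundary {G : Type*} [Group G]
    (α : G → G → G → ℂˣ)
    (hα : ∀ x y z : G, α 1 y z = 1 ∧ α x 1 z = 1 ∧ α x y 1 = 1) :
    ∀ a b c d : G,
      twisted3 (delta3 α) a b c d =
        betaSlant α (b⁻¹ * a * b) c d * betaSlant α a b (c * d) *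
          (betaSlant α a (b * c) d * betaSlant α a b c)⁻¹ := by
  intro a b c d
  simp only [twisted3, delta3, betaSlant, mul_inv_rev, mul_assoc, mul_inv_cancel_left,
    inv_mul_cancel_left, inv_inv]
  apply Units.ext
  push_cast
  field_simp
end

section
/- Let G be a group, α a normalized 3-cochain on G, and ω := δα its coboundary, with associated twisted 3-cocycles [·,·,·]_u and doubly-twisted 2-cochains β_{a,b}. Define β_a(x,y) := α(a,x,y) · α(x,y,(xy)⁻¹a(xy)) · α(x, x⁻¹ax, y)⁻¹ and ε_{a,b}(x) := β_a(x, x⁻¹bx) · β_a(b,x)⁻¹. Then for all a, b ∈ G with ab = ba and all x, y ∈ G, the doubly-twisted 2-cochain of ω is the doubly-twisted coboundary of ε: β_{a,b}(x,y) = ε_{x⁻¹ax, x⁻¹bx}(y) · ε_{a,b}(x) · ε_{a,b}(xy)⁻¹. -/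
/-- When `ω = δα` is a coboundary and `ab = ba`, the doubly-twisted 2-cochain of `ω` is
the doubly-twisted coboundary of `ε_{a,b}`. -/
theorem dtwisted2_of_coboundary_eq_dtwisted_coboundary {G : Type*} [Group G]
    (α : G → G → G → ℂˣ)
    (hα : ∀ x y z : G, α 1 y z = 1 ∧ α x 1 z = 1 ∧ α x y 1 = 1) :
    ∀ a b : G, a * b = b * a → ∀ x y : G,
      dtwisted2 (delta3 α) a b x y =
        epsSlant α (x⁻¹ * a * x) (x⁻¹ * b * x) y * epsSlant α a b x *
          (epsSlant α a b (x * y))⁻¹ := by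
  intro a b hab x y
  have hab' : ∀ t : G, a * (b * t) = b * (a * t) := fun t => by
    rw [← mul_assoc, hab, mul_assoc]
  simp only [dtwisted2, twisted3, delta3, epsSlant, betaSlant]
  simp only [mul_assoc, mul_inv_rev, mul_inv_cancel_left, inv_mul_cancel_left, inv_inv, hab, hab',
    mul_inv_cancel, inv_mul_cancel, mul_one, one_mul]
  apply Units.ext
  push_cast
  field_simp
end

section
/- Let m be a prime number and p an integer not divisible by m, and let G = (ℤ/mℤ)⁴, written additively with components a = (a₁,a₂,a₃,a₄). For a, b, c, d ∈ G define the Type IV doubly-twisted 2-cocycle β_{a,b}(c,d) := exp( (2πi·p/m) · E(a,b,c,d) ), where E(a,b,c,d) := (a₄b₃ − a₃b₄)c₁d₂ + (a₂b₄ − a₄b₂)c₁d₃ + (a₄b₁ − a₁b₄)c₂d₃ + (a₃b₂ − a₂b₃)c₁d₄ + (a₁b₃ − a₃b₁)c₂d₄ + (a₂b₁ − a₁b₂)c₃d₄, computed using integer representatives of the components (the value of β is well defined since E is well defined modulo m). Call c ∈ G β_{a,b}-regular if β_{a,b}(c,d) = β_{a,b}(d,c) for all d ∈ G. Then the ground state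 degeneracy of the Type IV twisted (ℤ/mℤ)⁴ gauge theory model on the 3-torus, namely the number of triples (a,b,c) ∈ G×G×G such that c is β_{a,b}-regular, equals m³ − m⁵ − m⁶ − m⁷ + m⁸ + m⁹ + m¹⁰. -/
/-- The group `(ℤ/mℤ)⁴` with components `a = (a₁,a₂,a₃,a₄)`. -/
abbrev Zm4 (m : ℕ) := ZMod m × ZMod m × ZMod m × ZMod m

/-- The integer exponent `E(a,b,c,d)` of the Type IV doubly-twisted 2-cocycle, computed
with the integer representatives of the components. -/
def typeIVExp {m : ℕ} (a b c d : Zm4 m) : ℤ :=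
  ((a.2.2.2.val : ℤ) * (b.2.2.1.val : ℤ) - (a.2.2.1.val : ℤ) * (b.2.2.2.val : ℤ)) *
      (c.1.val : ℤ) * (d.2.1.val : ℤ) +
    ((a.2.1.val : ℤ) * (b.2.2.2.val : ℤ) - (a.2.2.2.val : ℤ) * (b.2.1.val : ℤ)) *
      (c.1.val : ℤ) * (d.2.2.1.val : ℤ) +
    ((a.2.2.2.val : ℤ) * (b.1.val : ℤ) - (a.1.val : ℤ) * (b.2.2.2.val : ℤ)) *
      (c.2.1.val : ℤ) * (d.2.2.1.val : ℤ) +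
    ((a.2.2.1.val : ℤ) * (b.2.1.val : ℤ) - (a.2.1.val : ℤ) * (b.2.2.1.val : ℤ)) *
      (c.1.val : ℤ) * (d.2.2.2.val : ℤ) +
    ((a.1.val : ℤ) * (b.2.2.1.val : ℤ) - (a.2.2.1.val : ℤ) * (b.1.val : ℤ)) *
      (c.2.1.val : ℤ) * (d.2.2.2.val : ℤ) +
    ((a.2.1.val : ℤ) * (b.1.val : ℤ) - (a.1.val : ℤ) * (b.2.1.val : ℤ)) *
      (c.2.2.1.val : ℤ) * (d.2.2.2.val : ℤ)

/-- The Type IV doubly-twisted 2-cocycle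
`β_{a,b}(c,d) = exp(2πi·p/m · E(a,b,c,d))`. -/
noncomputable def typeIVBeta (m : ℕ) (p : ℤ) (a b c d : Zm4 m) : ℂ :=
  Complex.exp (2 * (Real.pi : ℂ) * Complex.I * (p : ℂ) / (m : ℂ) *
    ((typeIVExp a b c d : ℤ) : ℂ))

def typeIVVec {m : ℕ} (a : Zm4 m) : Fin 4 → ZMod m := ![a.1, a.2.1, a.2.2.1, a.2.2.2]

def typeIVVecEquiv (m : ℕ) : Zm4 m ≃ (Fin 4 → ZMod m) where
  toFun := typeIVVec
  invFun v := (v 0, v 1, v 2, v 3)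
  left_inv a := rfl
  right_inv v := by ext i; fin_cases i <;> rfl

def typeIVTripleEquiv (V W : Type) (e : V ≃ W) : V × V × V ≃ (Fin 3 → W) where
  toFun t := ![e t.1, e t.2.1, e t.2.2]
  invFun v := (e.symm (v 0), e.symm (v 1), e.symm (v 2))
  left_inv a := by simp
  right_inv v := by ext i; fin_cases i <;> simp

lemma typeIVExp_det {m : ℕ} [NeZero m] (a b c d : Zm4 m) :
    ((typeIVExp a b c d - typeIVExp a b d c : ℤ) : ZMod m) =
      Matrix.det (Matrix.of
        (Fin.cons (typeIVVec d) ![typeIVVec a, typeIVVec b, typeIVVec c] :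
          Fin 4 → Fin 4 → ZMod m)) := by
  obtain ⟨a1, a2, a3, a4⟩ := a
  obtain ⟨b1, b2, b3, b4⟩ := b
  obtain ⟨c1, c2, c3, c4⟩ := c
  obtain ⟨d1, d2, d3, d4⟩ := d
  simp [typeIVExp, typeIVVec, Matrix.det_succ_row_zero, Fin.sum_univ_succ, Fin.succAbove,
    ZMod.natCast_zmod_val, Fin.cons]
  ring

lemma typeIVBeta_eq_iff {m : ℕ} (hm : m.Prime) (p : ℤ) (hp : ¬ ((m : ℤ) ∣ p))
    (a b c d : Zm4 m) :
    typeIVBeta m p a b c d = typeIVBeta m p a b d c ↔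
      ((typeIVExp a b c d - typeIVExp a b d c : ℤ) : ZMod m) = 0 := by
  rw [ZMod.intCast_zmod_eq_zero_iff_dvd]
  unfold typeIVBeta
  rw [Complex.exp_eq_exp_iff_exists_int]
  generalize typeIVExp a b c d = x
  generalize typeIVExp a b d c = y
  have hm0 : (m : ℂ) ≠ 0 := by exact_mod_cast hm.ne_zero
  have hpi : (Real.pi : ℂ) ≠ 0 := by exact_mod_cast Real.pi_ne_zero
  have hI := Complex.I_ne_zero
  have key : ∀ n : ℤ, (2 * (Real.pi : ℂ) * Complex.I * (p : ℂ) / (m : ℂ) * (x : ℂ) =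
      2 * (Real.pi : ℂ) * Complex.I * (p : ℂ) / (m : ℂ) * (y : ℂ) +
        n * (2 * Real.pi * Complex.I)) ↔ p * (x - y) = m * n := by
    intro n
    have h2 : (2 * (Real.pi : ℂ) * Complex.I) ≠ 0 := by simp [hpi]
    rw [← @Int.cast_inj ℂ]
    push_cast
    constructor
    · intro h
      field_simp at h
      linear_combination h
    · intro h
      field_simp
      linear_combination h
  simp only [key]
  constructor
  · rintro ⟨n, hn⟩
    exact ((Nat.prime_iff_prime_int.mp hm).dvd_or_dvd ⟨n, hn⟩).resolve_left hp
  · rintro ⟨k, hk⟩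
    exact ⟨p * k, by rw [hk]; ring⟩

lemma typeIV_regular_iff {m : ℕ} [Fact m.Prime] (s : Fin 3 → Fin 4 → ZMod m) :
    (∀ d : Fin 4 → ZMod m, Matrix.det (Matrix.of (Fin.cons d s : Fin 4 → Fin 4 → ZMod m)) = 0) ↔
      ¬ LinearIndependent (ZMod m) s := by
  have key : ∀ d : Fin 4 → ZMod m,
      Matrix.det (Matrix.of (Fin.cons d s : Fin 4 → Fin 4 → ZMod m)) ≠ 0 ↔
        LinearIndependent (ZMod m) s ∧ d ∉ Submodule.span (ZMod m) (Set.range s) := by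
    intro d
    rw [← linearIndependent_finCons, ← isUnit_iff_ne_zero, ← Matrix.isUnit_iff_isUnit_det,
      ← Matrix.linearIndependent_rows_iff_isUnit]
    rfl
  constructor
  · intro h hs
    have hlt : Submodule.span (ZMod m) (Set.range s) < ⊤ := by
      apply Submodule.lt_top_of_finrank_lt_finrank
      rw [finrank_span_eq_card hs]
      simp
    obtain ⟨d, -, hd⟩ := SetLike.exists_of_lt hlt
    exact (key d).2 ⟨hs, hd⟩ (h d)
  · intro hs d
    by_contra hd
    exact hs ((key d).1 hd).1

/-- The ground state degeneracy of the Type IV twisted `(ℤ/mℤ)⁴` gauge theory model on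
the 3-torus: the number of triples `(a,b,c)` such that `c` is `β_{a,b}`-regular equals
`m³ − m⁵ − m⁶ − m⁷ + m⁸ + m⁹ + m¹⁰`, for `m` prime and `p` coprime to `m`. -/
theorem typeIV_GSD_three_torus (m : ℕ) (hm : m.Prime) (p : ℤ) (hp : ¬ ((m : ℤ) ∣ p)) :
    (Nat.card {t : Zm4 m × Zm4 m × Zm4 m //
        ∀ d : Zm4 m, typeIVBeta m p t.1 t.2.1 t.2.2 d = typeIVBeta m p t.1 t.2.1 d t.2.2} : ℤ) =
      (m : ℤ) ^ 3 - (m : ℤ) ^ 5 - (m : ℤ) ^ 6 - (m : ℤ) ^ 7 +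
        (m : ℤ) ^ 8 + (m : ℤ) ^ 9 + (m : ℤ) ^ 10 := by
  classical
  have : Fact m.Prime := ⟨hm⟩
  let e := typeIVTripleEquiv (Zm4 m) (Fin 4 → ZMod m) (typeIVVecEquiv m)
  have hreg : ∀ t : Zm4 m × Zm4 m × Zm4 m,
      (∀ d : Zm4 m, typeIVBeta m p t.1 t.2.1 t.2.2 d = typeIVBeta m p t.1 t.2.1 d t.2.2) ↔
        ¬ LinearIndependent (ZMod m) (e t) := by
    intro t
    rw [← typeIV_regular_iff, ← (typeIVVecEquiv m).forall_congr_right]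
    refine forall_congr' fun d => ?_
    rw [typeIVBeta_eq_iff hm p hp, typeIVExp_det]
    rfl
  rw [Nat.card_congr (e.subtypeEquiv (q := fun s => ¬ LinearIndependent (ZMod m) s) hreg)]
  have h1 := card_linearIndependent (K := ZMod m) (V := Fin 4 → ZMod m) (k := 3) (by simp)
  have h2 := Fintype.card_subtype_compl
    (fun s : Fin 3 → Fin 4 → ZMod m => LinearIndependent (ZMod m) s)
  have h3 := Fintype.card_subtype_le
    (fun s : Fin 3 → Fin 4 → ZMod m => LinearIndependent (ZMod m) s)
  rw [Nat.card_eq_fintype_card] at h1 ⊢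
  rw [h2, Nat.cast_sub h3, h1]
  have hpos : 1 ≤ m := hm.one_le
  have l0 : 1 ≤ m ^ 4 := Nat.one_le_pow _ _ hpos
  have l1 : m ≤ m ^ 4 := Nat.le_self_pow (by norm_num) m
  have l2 : m ^ 2 ≤ m ^ 4 := Nat.pow_le_pow_right hpos (by norm_num)
  simp [Fin.prod_univ_succ, ZMod.card, Nat.cast_sub l0, Nat.cast_sub l1, Nat.cast_sub l2]
  ring
end
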